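/- Let X^δ ⊆ X and Y^δ ⊆ Y be subspaces, let Q : Y → Y be a bounded linear map with range contained in Y^δ and with (Bw)(μ − Qμ) = 0 for all w ∈ X^δ and μ ∈ Y, and set e_osc(g) := ‖g ∘ (Id − Q)‖_{Y'}. If u_0 ∈ X satisfies G_0(u_0) ≤ G_0(v) for all v ∈ X (u_0 minimizes the consistency error), then for every w ∈ X^δ one has the computable upper bound e_cons(u_0) ≤ max(1, ‖Q‖)·√(G_0^δ(w)) + e_osc(g). -/

import Mathlib

/-- The discrete dual norm `‖ℓ‖_{(Y^δ)'} = sup { ℓ μ : μ ∈ Y^δ, ‖μ‖ ≤ 1 }`. -/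
noncomputable def discreteDualNorm {Y : Type*} [NormedAddCommGroup Y]
    [InnerProductSpace ℝ Y] (Yδ : Submodule ℝ Y) (ℓ : Y →L[ℝ] ℝ) : ℝ :=
  sSup ((fun μ => ℓ μ) '' {μ : Y | μ ∈ Yδ ∧ ‖μ‖ ≤ 1})

theorem discreteDualNorm_nonneg {Y : Type*} [NormedAddCommGroup Y] [InnerProductSpace ℝ Y]
    (Yδ : Submodule ℝ Y) (ℓ : Y →L[ℝ] ℝ) : 0 ≤ discreteDualNorm Yδ ℓ :=
  Real.sSup_nonneg' ⟨0, ⟨0, ⟨Yδ.zero_mem, by simp⟩, map_zero ℓ⟩, le_rfl⟩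

theorem le_discreteDualNorm_mul_norm {Y : Type*} [NormedAddCommGroup Y]
    [InnerProductSpace ℝ Y] (Yδ : Submodule ℝ Y) (ℓ : Y →L[ℝ] ℝ) {μ : Y} (hμ : μ ∈ Yδ) :
    ℓ μ ≤ discreteDualNorm Yδ ℓ * ‖μ‖ := by
  rcases eq_or_ne μ 0 with rfl | h0
  · simp
  have hpos : 0 < ‖μ‖ := norm_pos_iff.2 h0
  have hbdd : BddAbove ((fun μ => ℓ μ) '' {μ : Y | μ ∈ Yδ ∧ ‖μ‖ ≤ 1}) := by
    refine ⟨‖ℓ‖, ?_⟩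
    rintro _ ⟨ν, ⟨-, hν⟩, rfl⟩
    exact (le_abs_self _).trans (ℓ.unit_le_opNorm ν hν)
  have h : ℓ (‖μ‖⁻¹ • μ) ≤ discreteDualNorm Yδ ℓ :=
    le_csSup hbdd ⟨_, ⟨Yδ.smul_mem _ hμ, by simp [norm_smul, hpos.ne']⟩, rfl⟩
  rwa [map_smul, smul_eq_mul, inv_mul_le_iff₀ hpos, mul_comm] at h

theorem abs_le_discreteDualNorm_mul_norm {Y : Type*} [NormedAddCommGroup Y]
    [InnerProductSpace ℝ Y] (Yδ : Submodule ℝ Y) (ℓ : Y →L[ℝ] ℝ) {μ : Y} (hμ : μ ∈ Yδ) :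
    |ℓ μ| ≤ discreteDualNorm Yδ ℓ * ‖μ‖ :=
  abs_le'.2 ⟨le_discreteDualNorm_mul_norm Yδ ℓ hμ, by
    simpa using le_discreteDualNorm_mul_norm Yδ ℓ (Yδ.neg_mem hμ)⟩

/-- The dual norm is controlled by the discrete dual norm, up to the part of the functional
that the projection `Q` does not see. -/
theorem norm_le_discreteDualNorm_add {Y : Type*} [NormedAddCommGroup Y]
    [InnerProductSpace ℝ Y] (Yδ : Submodule ℝ Y) (Q : Y →L[ℝ] Y) (hran : ∀ μ, Q μ ∈ Yδ)
    (ℓ : Y →L[ℝ] ℝ) :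
    ‖ℓ‖ ≤ ‖Q‖ * discreteDualNorm Yδ ℓ + ‖ℓ.comp (ContinuousLinearMap.id ℝ Y - Q)‖ := by
  have hD := discreteDualNorm_nonneg Yδ ℓ
  refine ℓ.opNorm_le_bound (by positivity) fun μ => ?_
  have hsplit : ℓ μ = ℓ (Q μ) + ℓ.comp (ContinuousLinearMap.id ℝ Y - Q) μ := by simp
  calc ‖ℓ μ‖ ≤ ‖ℓ (Q μ)‖ + ‖ℓ.comp (ContinuousLinearMap.id ℝ Y - Q) μ‖ := by
        rw [hsplit]; exact norm_add_le _ _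
    _ ≤ discreteDualNorm Yδ ℓ * (‖Q‖ * ‖μ‖)
          + ‖ℓ.comp (ContinuousLinearMap.id ℝ Y - Q)‖ * ‖μ‖ :=
        add_le_add ((abs_le_discreteDualNorm_mul_norm Yδ ℓ (hran μ)).trans
          (mul_le_mul_of_nonneg_left (Q.le_opNorm μ) hD))
          (ContinuousLinearMap.le_opNorm _ μ)
    _ = _ := by ring

theorem sqrt_sq_add_sq_le_of_le_mul_add {a b d e q : ℝ} (ha : 0 ≤ a) (hd : 0 ≤ d)
    (he : 0 ≤ e) (h : a ≤ q * d + e) :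
    √(a ^ 2 + b ^ 2) ≤ max 1 q * √(d ^ 2 + b ^ 2) + e := by
  set M := max 1 q
  set s := √(d ^ 2 + b ^ 2)
  have hM : 1 ≤ M := le_max_left _ _
  have hs : s ^ 2 = d ^ 2 + b ^ 2 := Real.sq_sqrt (by positivity)
  have hds : d ≤ s := Real.le_sqrt_of_sq_le (by nlinarith [sq_nonneg b])
  have haM : a ≤ M * d + e :=
    h.trans (by gcongr; exact le_max_right _ _)
  have hsq : a ^ 2 ≤ (M * d + e) ^ 2 := by gcongr
  have hb : b ^ 2 ≤ M ^ 2 * b ^ 2 := le_mul_of_one_le_left (sq_nonneg b) (one_le_pow₀ hM)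
  have hcross : M * d * e ≤ M * s * e := by gcongr
  have hMs : M ^ 2 * s ^ 2 = M ^ 2 * d ^ 2 + M ^ 2 * b ^ 2 := by rw [hs]; ring
  exact Real.sqrt_le_iff.2 ⟨by positivity, by linarith⟩

/-- Corollary 3.11: computable upper bound for the minimal consistency error. -/
theorem stmt_13
    {X Y Hω H₀ : Type*}
    [NormedAddCommGroup X] [InnerProductSpace ℝ X] [CompleteSpace X]
    [NormedAddCommGroup Y] [InnerProductSpace ℝ Y] [CompleteSpace Y]
    [NormedAddCommGroup Hω] [InnerProductSpace ℝ Hω] [CompleteSpace Hω]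
    [NormedAddCommGroup H₀] [InnerProductSpace ℝ H₀] [CompleteSpace H₀]
    (B : X →L[ℝ] (Y →L[ℝ] ℝ)) (Γ : X →L[ℝ] Hω) (γ₀ : X →L[ℝ] H₀)
    (g : Y →L[ℝ] ℝ) (f : Hω)
    (Xδ : Submodule ℝ X) (Yδ : Submodule ℝ Y)
    (Q : Y →L[ℝ] Y)
    (hran : ∀ μ : Y, Q μ ∈ Yδ)
    (hFortin : ∀ w ∈ Xδ, ∀ μ : Y, B w (μ - Q μ) = 0)
    (u₀ : X)
    (hmin : ∀ v : X,
      ‖B u₀ - g‖ ^ 2 + ‖Γ u₀ - f‖ ^ 2 ≤ ‖B v - g‖ ^ 2 + ‖Γ v - f‖ ^ 2) :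
    ∀ w ∈ Xδ,
      Real.sqrt (‖B u₀ - g‖ ^ 2 + ‖Γ u₀ - f‖ ^ 2) ≤
        max 1 ‖Q‖ *
          Real.sqrt (discreteDualNorm Yδ (B w - g) ^ 2 + ‖Γ w - f‖ ^ 2) +
        ‖g.comp (ContinuousLinearMap.id ℝ Y - Q)‖ := by
  intro w hw
  have hosc : (B w - g).comp (ContinuousLinearMap.id ℝ Y - Q)
      = -g.comp (ContinuousLinearMap.id ℝ Y - Q) := by
    ext μ
    have := hFortin w hw μ
    simp only [ContinuousLinearMap.comp_apply, sub_apply,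
      neg_apply, ContinuousLinearMap.id_apply, this, zero_sub]
  have hnorm := norm_le_discreteDualNorm_add Yδ Q hran (B w - g)
  rw [hosc, norm_neg] at hnorm
  exact (Real.sqrt_le_sqrt (hmin w)).trans (sqrt_sq_add_sq_le_of_le_mul_add
    (norm_nonneg _) (discreteDualNorm_nonneg _ _) (norm_nonneg _) hnorm)
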